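/- Let G be a finite group and R a unital ring together with additive subgroups R_g (g ∈ G) such that R = Σ_{g∈G} R_g and R_g·R_h ⊆ R_{gh} for all g,h ∈ G. Then 1 ∈ R_1 (where 1 ∈ G is the neutral element); that is, condition (SR3) is redundant for finite G. -/

import Mathlib

universe u v

theorem gsys_split {G : Type u} {R : Type v} [Ring R] (𝒜 : G → AddSubgroup R)
    (M : Set G) (r : G) {x : R} (hx : x ∈ ⨆ g, ⨆ (_ : g ∉ M), 𝒜 g) :
    ∃ a ∈ 𝒜 r, ∃ b ∈ ⨆ g, ⨆ (_ : g ∉ insert r M), 𝒜 g, a + b = x := by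
  rw [← AddSubgroup.mem_sup]
  refine (iSup₂_le ?_ : (⨆ g, ⨆ (_ : g ∉ M), 𝒜 g) ≤ _) hx
  intro g hg
  by_cases h : g = r
  · subst h; exact le_sup_left
  · refine le_trans ?_ le_sup_right
    exact le_iSup₂_of_le (f := fun g (_ : g ∉ insert r M) => 𝒜 g) g
      (by simp [h, hg]) le_rfl

theorem gsys_mul {G : Type u} {R : Type v} [Ring R] (𝒜 : G → AddSubgroup R)
    (p : G → Prop) (L : AddSubgroup R) (f : R →+ R)
    (hf : ∀ g, p g → ∀ a ∈ 𝒜 g, f a ∈ L) {x : R} (hx : x ∈ ⨆ g, ⨆ (_ : p g), 𝒜 g) :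
    f x ∈ L := by
  have : (⨆ g, ⨆ (_ : p g), 𝒜 g) ≤ L.comap f := iSup₂_le fun g hg a ha => hf g hg a ha
  exact this hx

theorem gsys_key {G : Type u} [Group G] [Finite G]
    {R : Type v} [Ring R] (𝒜 : G → AddSubgroup R)
    (hsup : (⨆ g, 𝒜 g) = ⊤)
    (hmul : ∀ {g h : G} {a b : R}, a ∈ 𝒜 g → b ∈ 𝒜 h → a * b ∈ 𝒜 (g * h)) (n : ℕ) :
    ∀ M : Set G, M.ncard = n → 1 ∉ M → (1 : R) ∈ ⨆ g, ⨆ (_ : g ∉ M), 𝒜 g := by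
  induction n with
  | zero =>
    intro M hM _
    rw [Set.ncard_eq_zero] at hM
    subst hM
    simp [hsup]
  | succ n ih =>
    intro M' hM' h1
    obtain ⟨r, M, hr, rfl, hM⟩ := Set.eq_insert_of_ncard_eq_succ hM'
    have mem : ∀ g, g ∉ insert r M → ∀ a ∈ 𝒜 g,
        a ∈ ⨆ g, ⨆ (_ : g ∉ insert r M), 𝒜 g := fun g hg a ha =>
      (le_iSup₂_of_le (f := fun g (_ : g ∉ insert r M) => 𝒜 g) g hg le_rfl) ha
    have h1M : (1 : G) ∉ M := fun h => h1 (Set.mem_insert_of_mem _ h)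
    obtain ⟨a, ha, b, hb, hab⟩ := gsys_split 𝒜 M r (ih M hM h1M)
    have hN := ih ((fun g => g * r⁻¹) '' M)
      (by rw [Set.ncard_image_of_injective _ (mul_left_injective r⁻¹), hM])
      (by
        rintro ⟨m, hm, h⟩
        have : m = r := by simpa [mul_inv_eq_one] using h
        exact hr (this ▸ hm))
    obtain ⟨x, hx, u, hu, hxu⟩ := gsys_split 𝒜 _ 1 hN
    have e : (1 : R) = x + (u * a + (b - x * b)) := by
      have hu' : u = 1 - x := by rw [← hxu]; abel
      have hb' : b = 1 - a := by rw [← hab]; abel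
      rw [hu', hb']; noncomm_ring
    rw [e]
    refine add_mem (mem 1 h1 x hx) (add_mem ?_ (sub_mem hb ?_))
    · refine gsys_mul 𝒜 _ _ (AddMonoidHom.mulRight a) ?_ hu
      intro g hg c hc
      refine mem (g * r) ?_ _ (hmul hc ha)
      rintro (h | h)
      · exact hg (Or.inl (by simpa using h))
      · exact hg (Or.inr ⟨g * r, h, by simp⟩)
    · refine gsys_mul 𝒜 _ _ (AddMonoidHom.mulLeft x) ?_ hb
      intro g hg c hc
      refine mem g hg _ ?_
      simpa using hmul hx hc

/-- Let `G` be a finite group and `R` a unital ring with additive subgroups `R_g` (`g ∈ G`)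
such that `R = Σ_g R_g` and `R_g · R_h ⊆ R_{gh}`.  Then `1 ∈ R_1`: condition (SR3) in the
definition of a systematic ring is redundant for finite `G`. -/
theorem one_mem_of_finite_G_system {G : Type u} [Group G] [Finite G]
    {R : Type v} [Ring R] (𝒜 : G → AddSubgroup R)
    (hsup : (⨆ g, 𝒜 g) = ⊤)
    (hmul : ∀ {g h : G} {a b : R}, a ∈ 𝒜 g → b ∈ 𝒜 h → a * b ∈ 𝒜 (g * h)) :
    (1 : R) ∈ 𝒜 1 := by
  have h := gsys_key 𝒜 hsup hmul _ {1}ᶜ rfl (by simp)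
  simpa using h
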